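/- arXiv:2506.16260 — 7 statements merged into one kernel-verified Lean document; each statement's English description precedes it below -/
import Mathlib

section
/- Fix t₁ ≥ 0, t₂ ≥ 0 and view p(n, t₁, t₂; λ) = e^{−λ t₁ t₂} (λ t₁ t₂)ⁿ / n! as a function of λ > 0, with p(−1, ·, ·; λ) = 0. Then for every integer n ≥ 0: (i) λ² ∂/∂λ p(n, t₁, t₂; λ) = n λ p(n, t₁, t₂; λ) − (n+1) λ p(n+1, t₁, t₂; λ); and (ii) ∂²/∂t₂∂t₁ p(n, t₁, t₂; λ) = −(λ² ∂/∂λ + λ)(p(n, t₁, t₂; λ) − p(n−1, t₁, t₂; λ)). -/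
/-- One-dimensional distribution of the Poisson random field on the plane with
parameter `lam`: `p(n, t₁, t₂) = e^{-λ t₁ t₂} (λ t₁ t₂)^n / n!` for `n ≥ 0`, and `0` for `n < 0`. -/
noncomputable def poissonP (lam : ℝ) (n : ℤ) (t₁ t₂ : ℝ) : ℝ :=
  if n < 0 then 0
  else Real.exp (-(lam * t₁ * t₂)) * (lam * t₁ * t₂) ^ n.toNat / (n.toNat).factorial

theorem poissonP_eq_unit_square (lam : ℝ) (n : ℤ) (t₁ t₂ : ℝ) :
    poissonP lam n t₁ t₂ = poissonP (lam * t₁ * t₂) n 1 1 := by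
  simp only [poissonP, mul_one]

theorem poissonP_natCast (x : ℝ) (n : ℕ) :
    poissonP x n 1 1 = Real.exp (-x) * x ^ n / n.factorial := by
  simp [poissonP]

theorem mul_poissonP_sub_one (x : ℝ) (n : ℤ) :
    x * poissonP x (n - 1) 1 1 = n * poissonP x n 1 1 := by
  rcases lt_or_ge n 0 with hn | hn
  · have hn' : n - 1 < 0 := by lia
    simp [poissonP, hn, hn']
  · lift n to ℕ using hn
    cases n with
    | zero => simp [poissonP]
    | succ m =>
      rw [Nat.cast_succ, add_sub_cancel_right, ← Nat.cast_succ, poissonP_natCast,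
        poissonP_natCast, Nat.factorial_succ]
      push_cast
      field_simp
      exact (pow_succ' x m).symm

theorem hasDerivAt_poissonP_unit_square (n : ℤ) (x : ℝ) :
    HasDerivAt (fun y => poissonP y n 1 1) (poissonP x (n - 1) 1 1 - poissonP x n 1 1) x := by
  rcases lt_or_ge n 0 with hn | hn
  · have hn' : n - 1 < 0 := by lia
    simpa [poissonP, hn, hn'] using hasDerivAt_const x (0 : ℝ)
  · lift n to ℕ using hn
    simp only [poissonP_natCast]
    have h := (((hasDerivAt_neg x).exp.mul (hasDerivAt_pow n x)).div_const (n.factorial : ℝ))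
    refine h.congr_deriv ?_
    cases n with
    | zero => simp [poissonP]
    | succ m =>
      rw [Nat.cast_succ (R := ℤ), add_sub_cancel_right, poissonP_natCast, Nat.factorial_succ]
      push_cast
      field_simp
      ring

theorem hasDerivAt_poissonP_intensity (lam : ℝ) (n : ℤ) (t₁ t₂ : ℝ) :
    HasDerivAt (fun l => poissonP l n t₁ t₂)
      ((poissonP lam (n - 1) t₁ t₂ - poissonP lam n t₁ t₂) * (t₁ * t₂)) lam := by
  simp only [fun l k => poissonP_eq_unit_square l k t₁ t₂]
  have h : HasDerivAt (fun l => l * t₁ * t₂) (t₁ * t₂) lam := by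
    simpa using ((hasDerivAt_id lam).mul_const t₁).mul_const t₂
  exact HasDerivAt.comp (h₂ := fun y => poissonP y n 1 1) lam
    (hasDerivAt_poissonP_unit_square n (lam * t₁ * t₂)) h

theorem hasDerivAt_poissonP_fst (lam : ℝ) (n : ℤ) (t₁ t₂ : ℝ) :
    HasDerivAt (fun r => poissonP lam n r t₂)
      ((poissonP lam (n - 1) t₁ t₂ - poissonP lam n t₁ t₂) * (lam * t₂)) t₁ := by
  simp only [fun r k => poissonP_eq_unit_square lam k r t₂]
  have h : HasDerivAt (fun r => lam * r * t₂) (lam * t₂) t₁ := by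
    simpa using ((hasDerivAt_id t₁).const_mul lam).mul_const t₂
  exact HasDerivAt.comp (h₂ := fun y => poissonP y n 1 1) t₁
    (hasDerivAt_poissonP_unit_square n (lam * t₁ * t₂)) h

theorem hasDerivAt_poissonP_snd (lam : ℝ) (n : ℤ) (t₁ t₂ : ℝ) :
    HasDerivAt (fun s => poissonP lam n t₁ s)
      ((poissonP lam (n - 1) t₁ t₂ - poissonP lam n t₁ t₂) * (lam * t₁)) t₂ := by
  simp only [fun s k => poissonP_eq_unit_square lam k t₁ s]
  have h : HasDerivAt (fun s => lam * t₁ * s) (lam * t₁) t₂ := by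
    simpa using (hasDerivAt_id t₂).const_mul (lam * t₁)
  exact HasDerivAt.comp (h₂ := fun y => poissonP y n 1 1) t₂
    (hasDerivAt_poissonP_unit_square n (lam * t₁ * t₂)) h

/-- (i) `λ² ∂/∂λ p(n) = nλ p(n) - (n+1)λ p(n+1)`, and
(ii) `∂²/∂t₂∂t₁ p(n) = -(λ² ∂/∂λ + λ)(p(n) - p(n-1))`. -/
theorem stmt1 (t₁ t₂ : ℝ) (ht₁ : 0 ≤ t₁) (ht₂ : 0 ≤ t₂) (lam : ℝ) (hlam : 0 < lam) (n : ℕ) :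
    lam ^ 2 * deriv (fun l => poissonP l n t₁ t₂) lam
      = (n : ℝ) * lam * poissonP lam n t₁ t₂
        - ((n : ℝ) + 1) * lam * poissonP lam ((n : ℤ) + 1) t₁ t₂
    ∧ deriv (fun s => deriv (fun r => poissonP lam n r s) t₁) t₂
      = -(lam ^ 2 *
            deriv (fun l => poissonP l n t₁ t₂ - poissonP l ((n : ℤ) - 1) t₁ t₂) lam
          + lam * (poissonP lam n t₁ t₂ - poissonP lam ((n : ℤ) - 1) t₁ t₂)) := by
  constructor
  · rw [(hasDerivAt_poissonP_intensity lam n t₁ t₂).deriv]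
    simp only [poissonP_eq_unit_square lam _ t₁ t₂]
    have h₁ := mul_poissonP_sub_one (lam * t₁ * t₂) n
    have h₂ := mul_poissonP_sub_one (lam * t₁ * t₂) (n + 1)
    rw [add_sub_cancel_right] at h₂
    push_cast at h₁ h₂
    linear_combination lam * h₁ - lam * h₂
  · simp only [fun s => (hasDerivAt_poissonP_fst lam n t₁ s).deriv]
    have h : HasDerivAt (fun s => lam * s) lam t₂ := by
      simpa using (hasDerivAt_id t₂).const_mul lam
    rw [(((hasDerivAt_poissonP_snd lam (n - 1) t₁ t₂).fun_sub
        (hasDerivAt_poissonP_snd lam n t₁ t₂)).fun_mul h).deriv,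
      ((hasDerivAt_poissonP_intensity lam n t₁ t₂).fun_sub
        (hasDerivAt_poissonP_intensity lam (n - 1) t₁ t₂)).deriv]
    ring
end

section
/- Let 0 ≤ s₁ ≤ s₂ and 0 ≤ t₂ ≤ t₁. Define φ : ℝ² → ℝ by φ(u, v) = exp( s₁ (t₁ − t₂)(e^{−u²/2} − 1) + s₁ t₂ (e^{−(u+v)²/2} − 1) + (s₂ − s₁) t₂ (e^{−v²/2} − 1) ). Then the mixed partial derivative of φ at the origin satisfies ∂²φ/∂u∂v (0, 0) = − s₁ t₂. (Hence the joint moment 𝔼 𝒳(s₁,t₁)𝒳(s₂,t₂) = −∂²φ/∂u∂v|_{(0,0)} of the normal compound Poisson random field equals s₁ t₂ = (s₁∧s₂)(t₁∧t₂) in this ordering.) -/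
/-- Joint characteristic function of the normal compound Poisson random field in the
ordering `s₁ ≤ s₂`, `t₂ ≤ t₁`: its mixed partial derivative at the origin equals `-s₁t₂`,
so the joint moment `𝔼 𝒳(s₁,t₁)𝒳(s₂,t₂)` equals `s₁t₂ = (s₁∧s₂)(t₁∧t₂)`. -/
theorem stmt3 (s₁ s₂ t₁ t₂ : ℝ) (hs₁ : 0 ≤ s₁) (hs : s₁ ≤ s₂) (ht₂ : 0 ≤ t₂) (ht : t₂ ≤ t₁) :
    deriv (fun u => deriv (fun v =>
        Real.exp (s₁ * (t₁ - t₂) * (Real.exp (-u ^ 2 / 2) - 1)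
          + s₁ * t₂ * (Real.exp (-(u + v) ^ 2 / 2) - 1)
          + (s₂ - s₁) * t₂ * (Real.exp (-v ^ 2 / 2) - 1))) 0) 0
      = -(s₁ * t₂) := by
  have hexp : ∀ c x : ℝ, HasDerivAt (fun y : ℝ => Real.exp (-(c + y) ^ 2 / 2))
      (Real.exp (-(c + x) ^ 2 / 2) * -(c + x)) x := fun c x => by
    refine (((((hasDerivAt_id x).const_add c).fun_pow 2).fun_neg.div_const 2).exp).congr_deriv ?_
    simp only [id]
    norm_num
    ring
  have hexp' : ∀ x : ℝ, HasDerivAt (fun y : ℝ => Real.exp (-y ^ 2 / 2))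
      (Real.exp (-x ^ 2 / 2) * -x) x := fun x => by simpa using hexp 0 x
  have hv : ∀ u : ℝ, deriv (fun v =>
        Real.exp (s₁ * (t₁ - t₂) * (Real.exp (-u ^ 2 / 2) - 1)
          + s₁ * t₂ * (Real.exp (-(u + v) ^ 2 / 2) - 1)
          + (s₂ - s₁) * t₂ * (Real.exp (-v ^ 2 / 2) - 1))) 0
      = Real.exp (s₁ * t₁ * (Real.exp (-u ^ 2 / 2) - 1))
          * (s₁ * t₂ * (Real.exp (-u ^ 2 / 2) * -u)) := fun u => by
    refine (((((hexp u 0).sub_const 1).const_mul (s₁ * t₂)).const_add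
      (s₁ * (t₁ - t₂) * (Real.exp (-u ^ 2 / 2) - 1))).add
      (((hexp' 0).sub_const 1).const_mul ((s₂ - s₁) * t₂))).exp.deriv.trans ?_
    simp only [Pi.add_apply, add_zero]
    norm_num
    left
    ring
  simp only [hv]
  refine ((((hexp' 0).sub_const 1).const_mul (s₁ * t₁)).exp.mul
    (((hexp' 0).mul (hasDerivAt_id (0 : ℝ)).fun_neg).const_mul (s₁ * t₂))).deriv.trans ?_
  simp
end

section
/- Let α₁, α₂ ∈ (0,1) with α₁ + α₂ > 1, and let c ≥ 0. Define W_c(t₁,t₂) = Σ_{k=0}^∞ k! (−c t₁^{α₁} t₂^{α₂})ᵏ / ( Γ(kα₁+1) Γ(kα₂+1) ) for t₁, t₂ ≥ 0. Then for all z₁ > 0, z₂ > 0, the double Laplace transform of W_c satisfies ∫₀^∞ ∫₀^∞ e^{−z₁t₁ − z₂t₂} W_c(t₁,t₂) dt₁ dt₂ = z₁^{α₁−1} z₂^{α₂−1} ∫₀^∞ ∫₀^∞ e^{−c x₁ x₂ − z₁^{α₁} x₁ − z₂^{α₂} x₂} dx₁ dx₂. -/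
open MeasureTheory

/-- The generalized Wright function
`₂Ψ₂[(1,1),(1,1);(1,α₁),(1,α₂) | x] = Σ_{k=0}^∞ k! xᵏ/(Γ(kα₁+1)Γ(kα₂+1))`. -/
noncomputable def wright22 (α₁ α₂ x : ℝ) : ℝ :=
  ∑' k : ℕ, (k.factorial : ℝ) * x ^ k / (Real.Gamma ((k : ℝ) * α₁ + 1) * Real.Gamma ((k : ℝ) * α₂ + 1))

/-- The sum of the power series with coefficients `a`. -/
noncomputable def powSum (a : ℕ → ℝ) (x : ℝ) : ℝ := ∑' k : ℕ, a k * x ^ k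

/-- `a` is the coefficient sequence of an entire power series whose sum is bounded by `1` in
absolute value on the negative half-line. -/
structure BoundedOnNeg (a : ℕ → ℝ) : Prop where
  summable_abs : ∀ r : ℝ, 0 ≤ r → Summable fun k : ℕ => |a k| * r ^ k
  abs_powSum_le : ∀ x : ℝ, x ≤ 0 → |powSum a x| ≤ 1

namespace BoundedOnNeg

variable {a : ℕ → ℝ}

theorem summable (ha : BoundedOnNeg a) (x : ℝ) : Summable fun k : ℕ => a k * x ^ k := by
  refine Summable.of_norm ?_
  simpa [abs_mul, abs_pow] using ha.summable_abs |x| (abs_nonneg x)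

theorem measurable_powSum (ha : BoundedOnNeg a) : Measurable (powSum a) := by
  refine measurable_of_tendsto_metrizable
    (f := fun n x => ∑ k ∈ Finset.range n, a k * x ^ k) (fun n => by fun_prop) ?_
  rw [tendsto_pi_nhds]
  exact fun x => (ha.summable x).hasSum.tendsto_sum_nat

theorem mul_pow (ha : BoundedOnNeg a) {l : ℝ} (hl : 0 ≤ l) :
    BoundedOnNeg fun k => a k * l ^ k where
  summable_abs r hr := by
    refine (ha.summable_abs (l * r) (by positivity)).congr fun k => ?_
    rw [abs_mul, abs_of_nonneg (pow_nonneg hl k), _root_.mul_pow]; ring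
  abs_powSum_le x hx := by
    have h := ha.abs_powSum_le (l * x) (mul_nonpos_of_nonneg_of_nonpos hl hx)
    simpa [powSum, _root_.mul_pow, mul_assoc] using h

/-- Averaging the sum of the series over dilations by `v ∈ [0, 1]` with density
`(m + 1) v ^ m` multiplies its coefficients by `(m + 1) / (k + m + 1)`. -/
theorem hasSum_average (ha : BoundedOnNeg a) (m : ℕ) (x : ℝ) :
    HasSum (fun k : ℕ => a k * x ^ k * ((m + 1) / (k + (m + 1))))
      (∫ v in Set.Ioc (0 : ℝ) 1, (m + 1) * v ^ m * powSum a (v * x)) := by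
  have hI (k : ℕ) (b : ℝ) : (∫ v in Set.Ioc (0 : ℝ) 1, b * ((m + 1) * v ^ (m + k))) =
      b * ((m + 1) / (k + (m + 1))) := by
    rw [integral_const_mul, integral_const_mul, ← intervalIntegral.integral_of_le zero_le_one,
      integral_pow]
    push_cast
    simp
    left
    rw [div_eq_mul_inv]
    congr 2
    ring
  have h := hasSum_integral_of_summable_integral_norm
    (μ := volume.restrict (Set.Ioc (0 : ℝ) 1))
    (F := fun (k : ℕ) v => a k * x ^ k * ((m + 1) * v ^ (m + k))) (fun k => by
      have : Continuous fun v : ℝ => a k * x ^ k * ((m + 1) * v ^ (m + k)) := by fun_prop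
      exact this.integrableOn_Ioc) (by
      refine Summable.of_nonneg_of_le (fun k => integral_nonneg fun _ => norm_nonneg _)
        (fun k => ?_) (ha.summable_abs |x| (abs_nonneg x))
      calc (∫ v in Set.Ioc (0 : ℝ) 1, ‖a k * x ^ k * ((m + 1) * v ^ (m + k))‖)
          = ∫ v in Set.Ioc (0 : ℝ) 1, |a k * x ^ k| * ((m + 1) * v ^ (m + k)) := by
            refine setIntegral_congr_fun measurableSet_Ioc fun v hv => ?_
            have h0 : 0 ≤ (m + 1) * v ^ (m + k) := by have := hv.1.le; positivity
            simp only [Real.norm_eq_abs]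
            rw [abs_mul, abs_of_nonneg h0]
        _ = |a k| * |x| ^ k * ((m + 1) / (k + (m + 1))) := by rw [hI, abs_mul, abs_pow]
        _ ≤ |a k| * |x| ^ k := by
            refine mul_le_of_le_one_right (by positivity) ?_
            rw [div_le_one (by positivity)]
            linarith [Nat.cast_nonneg (α := ℝ) k])
  simp only [hI] at h
  have hv (v : ℝ) : (m + 1) * v ^ m * powSum a (v * x) =
      ∑' k : ℕ, a k * x ^ k * ((m + 1) * v ^ (m + k)) := by
    rw [powSum, ← tsum_mul_left]
    refine tsum_congr fun k => ?_
    rw [_root_.mul_pow, pow_add]; ring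
  simpa only [hv] using h

theorem mul_div (ha : BoundedOnNeg a) {α : ℝ} (h0 : 0 ≤ α) (h1 : α ≤ 1) (m : ℕ) :
    BoundedOnNeg fun k => a k * ((α * k + (m + 1)) / (k + (m + 1))) := by
  have hs (x : ℝ) : HasSum (fun k : ℕ => a k * ((α * k + (m + 1)) / (k + (m + 1))) * x ^ k)
      (α * powSum a x
        + (1 - α) * ∫ v in Set.Ioc (0 : ℝ) 1, (m + 1) * v ^ m * powSum a (v * x)) := by
    have h := ((ha.summable x).hasSum.mul_left α).add
      ((ha.hasSum_average m x).mul_left (1 - α))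
    rw [show (fun k : ℕ => a k * ((α * k + (m + 1)) / (k + (m + 1))) * x ^ k) = fun k : ℕ =>
        α * (a k * x ^ k) + (1 - α) * (a k * x ^ k * ((m + 1) / (k + (m + 1)))) from ?_]
    · exact h
    ext k
    have : (k : ℝ) + (m + 1) ≠ 0 := by positivity
    field_simp
    ring
  constructor
  · intro r hr
    refine Summable.of_nonneg_of_le (fun k => mul_nonneg (abs_nonneg _) (pow_nonneg hr k)) (fun k => ?_)
      (ha.summable_abs r hr)
    refine mul_le_mul_of_nonneg_right ?_ (pow_nonneg hr k)
    rw [abs_mul]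
    refine mul_le_of_le_one_right (abs_nonneg _) ?_
    rw [abs_of_nonneg (by positivity), div_le_one (by positivity)]
    gcongr
    exact mul_le_of_le_one_left (by positivity) h1
  · intro x hx
    have hav : |∫ v in Set.Ioc (0 : ℝ) 1, (m + 1) * v ^ m * powSum a (v * x)| ≤ 1 := by
      have hc : Continuous fun v : ℝ => ((m : ℝ) + 1) * v ^ m := by fun_prop
      have := norm_integral_le_of_norm_le (μ := volume.restrict (Set.Ioc (0 : ℝ) 1))
        (f := fun v => ((m : ℝ) + 1) * v ^ m * powSum a (v * x))
        (g := fun v : ℝ => ((m : ℝ) + 1) * v ^ m) hc.integrableOn_Ioc (by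
          refine ae_restrict_of_forall_mem measurableSet_Ioc fun v hv => ?_
          have hv0 := hv.1.le
          rw [Real.norm_eq_abs, abs_mul, abs_of_nonneg (by positivity)]
          exact mul_le_of_le_one_right (by positivity)
            (ha.abs_powSum_le _ (mul_nonpos_of_nonneg_of_nonpos hv0 hx)))
      refine this.trans_eq ?_
      rw [integral_const_mul, ← intervalIntegral.integral_of_le zero_le_one, integral_pow]
      have : (m : ℝ) + 1 ≠ 0 := by positivity
      simp
      field_simp
    rw [powSum, (hs x).tsum_eq]
    calc _ ≤ α * |powSum a x|
          + (1 - α) * |∫ v in Set.Ioc (0 : ℝ) 1, (m + 1) * v ^ m * powSum a (v * x)| := by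
            refine (abs_add_le _ _).trans_eq ?_
            rw [abs_mul, abs_mul, abs_of_nonneg h0, abs_of_nonneg (sub_nonneg.2 h1)]
      _ ≤ α * 1 + (1 - α) * 1 := by
            have := ha.abs_powSum_le x hx
            have := sub_nonneg.2 h1
            gcongr
      _ = 1 := by ring

theorem mul_prod (ha : BoundedOnNeg a) {α : ℝ} (h0 : 0 ≤ α) (h1 : α ≤ 1) (N : ℕ) :
    BoundedOnNeg fun k =>
      a k * ∏ j ∈ Finset.range N, (α * k + (j + 1)) / ((k : ℝ) + (j + 1)) := by
  induction N with
  | zero => simpa using ha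
  | succ N ih =>
    simp only [Finset.prod_range_succ, ← mul_assoc]
    exact ih.mul_div h0 h1 N

end BoundedOnNeg

theorem powSum_inv_factorial (x : ℝ) : powSum (fun k => 1 / (k.factorial : ℝ)) x = Real.exp x := by
  rw [Real.exp_eq_exp_ℝ, NormedSpace.exp_eq_tsum_div]
  exact tsum_congr fun k => by ring

theorem boundedOnNeg_inv_factorial : BoundedOnNeg fun k => 1 / (k.factorial : ℝ) where
  summable_abs r _ := by
    refine (Real.summable_pow_div_factorial r).congr fun k => ?_
    rw [abs_of_nonneg (by positivity)]; ring
  abs_powSum_le x hx := by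
    rw [powSum_inv_factorial, Real.abs_exp]
    exact Real.exp_le_one_iff.2 hx

/-- The quotient `GammaSeq (k + 1) N / GammaSeq (α * k + 1) N`, approximating the `k`-th moment
`k! / Γ(α k + 1)` of the Mittag-Leffler distribution. -/
noncomputable def mittagLefflerMoment (α : ℝ) (N k : ℕ) : ℝ :=
  ((N : ℝ) ^ (1 - α)) ^ k *
    ∏ j ∈ Finset.range (N + 1), (α * k + (j + 1)) / ((k : ℝ) + (j + 1))

theorem mittagLefflerMoment_nonneg {α : ℝ} (h0 : 0 ≤ α) (N k : ℕ) :
    0 ≤ mittagLefflerMoment α N k :=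
  mul_nonneg (by positivity) (Finset.prod_nonneg fun j _ => by positivity)

theorem gammaSeq_pos {s : ℝ} (hs : 0 < s) {N : ℕ} (hN : 0 < N) : 0 < Real.GammaSeq s N := by
  unfold Real.GammaSeq
  exact div_pos (by positivity) (Finset.prod_pos fun j _ => by positivity)

theorem mittagLefflerMoment_mul_gammaSeq {α : ℝ} (h0 : 0 ≤ α) {N : ℕ} (hN : 0 < N) (k : ℕ) :
    mittagLefflerMoment α N k * Real.GammaSeq (α * k + 1) N = Real.GammaSeq (k + 1) N := by
  have hN' : (0 : ℝ) < N := by exact_mod_cast hN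
  have hp : (∏ j ∈ Finset.range (N + 1), (α * k + 1 + j : ℝ)) ≠ 0 :=
    (Finset.prod_pos fun j _ => by positivity).ne'
  have hpow : (N : ℝ) ^ ((k : ℝ) + 1) = ((N : ℝ) ^ (1 - α)) ^ k * (N : ℝ) ^ (α * k + 1) := by
    rw [← Real.rpow_mul_natCast hN'.le, ← Real.rpow_add hN']; congr 1; ring
  unfold mittagLefflerMoment Real.GammaSeq
  rw [Finset.prod_div_distrib, hpow]
  simp only [add_assoc, add_comm (1 : ℝ)] at hp ⊢
  field_simp

theorem tendsto_mittagLefflerMoment {α : ℝ} (h0 : 0 ≤ α) (k : ℕ) :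
    Filter.Tendsto (fun N => mittagLefflerMoment α N k) Filter.atTop
      (nhds (k.factorial / Real.Gamma (k * α + 1))) := by
  rw [← Real.Gamma_nat_eq_factorial, mul_comm (k : ℝ) α]
  refine ((Real.GammaSeq_tendsto_Gamma (k + 1)).div (Real.GammaSeq_tendsto_Gamma (α * k + 1))
    (Real.Gamma_pos_of_pos (by positivity)).ne').congr' ?_
  filter_upwards [Filter.eventually_gt_atTop 0] with N hN
  rw [Pi.div_apply, div_eq_iff (gammaSeq_pos (by positivity) hN).ne',
    mittagLefflerMoment_mul_gammaSeq h0 hN]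

theorem mittagLefflerMoment_le_succ {α : ℝ} (h0 : 0 ≤ α) (h1 : α ≤ 1) {N : ℕ} (hN : 0 < N)
    (k : ℕ) : mittagLefflerMoment α N k ≤ mittagLefflerMoment α (N + 1) k := by
  have hN' : (0 : ℝ) < N := by exact_mod_cast hN
  have hα := sub_nonneg.2 h1
  have hr : 1 / ((N : ℝ) + 1) ≤ Real.log ((N + 1) / N) := by
    have := Real.one_sub_inv_le_log_of_pos (x := ((N : ℝ) + 1) / N) (by positivity)
    refine le_trans (le_of_eq ?_) this
    field_simp
    ring
  have hfac : ((k : ℝ) + (N + 1 + 1)) / (α * k + (N + 1 + 1)) ≤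
      (((N : ℝ) + 1) ^ (1 - α)) ^ k / ((N : ℝ) ^ (1 - α)) ^ k := by
    calc ((k : ℝ) + (N + 1 + 1)) / (α * k + (N + 1 + 1))
        = (1 - α) * k / (α * k + (N + 1 + 1)) + 1 := by field_simp; ring
      _ ≤ (1 - α) * k * (1 / ((N : ℝ) + 1)) + 1 := by
          rw [mul_one_div]
          refine add_le_add (div_le_div_of_nonneg_left (by positivity) (by positivity) ?_) le_rfl
          linarith [mul_nonneg h0 (Nat.cast_nonneg (α := ℝ) k)]
      _ ≤ Real.log ((N + 1) / N) * ((1 - α) * k) + 1 := by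
          rw [mul_comm _ (1 / ((N : ℝ) + 1))]; gcongr
      _ ≤ Real.exp (Real.log ((N + 1) / N) * ((1 - α) * k)) := Real.add_one_le_exp _
      _ = _ := by
          rw [← Real.rpow_def_of_pos (by positivity), Real.rpow_mul_natCast (by positivity),
            Real.div_rpow (by positivity) (by positivity), div_pow]
  unfold mittagLefflerMoment
  rw [Finset.prod_range_succ _ (N + 1)]
  push_cast
  set P := ∏ j ∈ Finset.range (N + 1), (α * k + (j + 1)) / ((k : ℝ) + (j + 1))
  have hP : 0 ≤ P := Finset.prod_nonneg fun j _ => by positivity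
  rw [div_le_div_iff₀ (by positivity) (by positivity)] at hfac
  rw [← mul_assoc, ← mul_div_assoc, le_div_iff₀ (by positivity)]
  nlinarith [mul_le_mul_of_nonneg_left hfac hP]

theorem mittagLefflerMoment_le {α : ℝ} (h0 : 0 ≤ α) (h1 : α ≤ 1) {N : ℕ} (hN : 0 < N) (k : ℕ) :
    mittagLefflerMoment α N k ≤ k.factorial / Real.Gamma (k * α + 1) := by
  have hm : Monotone fun n => mittagLefflerMoment α (n + N) k :=
    monotone_nat_of_le_succ fun n => by
      simpa [add_right_comm] using mittagLefflerMoment_le_succ h0 h1 (N := n + N) (by omega) k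
  simpa using hm.ge_of_tendsto
    ((Filter.tendsto_add_atTop_iff_nat N).2 (tendsto_mittagLefflerMoment h0 k)) 0

theorem rpow_mul_exp_neg_le_gamma {a M : ℝ} (ha : 0 ≤ a) (hM : 0 ≤ M) :
    M ^ a * Real.exp (-M) ≤ Real.Gamma (a + 1) := by
  have hint := Real.GammaIntegral_convergent (s := a + 1) (by positivity)
  rw [Real.Gamma_eq_integral (by positivity)]
  simp only [add_sub_cancel_right] at hint ⊢
  calc M ^ a * Real.exp (-M) = ∫ x in Set.Ioi M, M ^ a * Real.exp (-x) := by
        rw [integral_const_mul, integral_exp_neg_Ioi]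
    _ ≤ ∫ x in Set.Ioi M, Real.exp (-x) * x ^ a := by
        refine setIntegral_mono_on ((integrableOn_exp_neg_Ioi M).const_mul _)
          (hint.mono_set (Set.Ioi_subset_Ioi hM)) measurableSet_Ioi fun x hx => ?_
        rw [mul_comm]
        have : M ≤ x := le_of_lt hx
        gcongr
    _ ≤ ∫ x in Set.Ioi 0, Real.exp (-x) * x ^ a := by
        refine setIntegral_mono_set hint ?_ (Set.Ioi_subset_Ioi hM).eventuallyLE
        exact ae_restrict_of_forall_mem measurableSet_Ioi fun x hx => by
          have : (0 : ℝ) ≤ x := le_of_lt hx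
          simp only [Pi.zero_apply]
          positivity

theorem summable_wright22 {α₁ α₂ : ℝ} (h₁ : 0 ≤ α₁) (h₂ : 0 ≤ α₂) (hsum : 1 < α₁ + α₂)
    {r : ℝ} (hr : 0 ≤ r) :
    Summable fun k : ℕ => (k.factorial : ℝ) * r ^ k /
      (Real.Gamma (k * α₁ + 1) * Real.Gamma (k * α₂ + 1)) := by
  have hlim : Filter.Tendsto (fun k : ℕ => Real.exp 2 * r * (k : ℝ) ^ (-(α₁ + α₂ - 1)))
      Filter.atTop (nhds 0) := by
    simpa using ((tendsto_rpow_neg_atTop (sub_pos.2 hsum)).comp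
      tendsto_natCast_atTop_atTop).const_mul (Real.exp 2 * r)
  refine Summable.of_norm_bounded_eventually_nat
    (summable_geometric_of_lt_one (r := 1 / 2) (by norm_num) (by norm_num)) ?_
  filter_upwards [hlim.eventually_le_const (by norm_num : (0 : ℝ) < 1 / 2),
    Filter.eventually_gt_atTop 0] with k hk hk0
  have hk' : (0 : ℝ) < k := by exact_mod_cast hk0
  have hG (α : ℝ) (h : 0 ≤ α) : 0 < Real.Gamma (k * α + 1) :=
    Real.Gamma_pos_of_pos (by positivity)
  have hG₁ := hG α₁ h₁
  have hG₂ := hG α₂ h₂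
  rw [Real.norm_of_nonneg (by positivity)]
  refine le_trans ?_ (pow_le_pow_left₀ (by positivity) hk k)
  have hfac : (k.factorial : ℝ) ≤ (k : ℝ) ^ k := by exact_mod_cast Nat.factorial_le_pow k
  calc (k.factorial : ℝ) * r ^ k / (Real.Gamma (k * α₁ + 1) * Real.Gamma (k * α₂ + 1))
      ≤ (k : ℝ) ^ k * r ^ k / (((k : ℝ) ^ (k * α₁) * Real.exp (-k)) *
          ((k : ℝ) ^ (k * α₂) * Real.exp (-k))) := by
        gcongr
        · exact rpow_mul_exp_neg_le_gamma (by positivity) hk'.le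
        · exact rpow_mul_exp_neg_le_gamma (by positivity) hk'.le
    _ = (Real.exp 2 * r * (k : ℝ) ^ (-(α₁ + α₂ - 1))) ^ k := by
        rw [mul_pow, mul_pow, ← Real.exp_nat_mul, ← Real.rpow_mul_natCast hk'.le]
        have e1 : (k : ℝ) ^ (-(α₁ + α₂ - 1) * k) =
            (k : ℝ) ^ k / ((k : ℝ) ^ (k * α₁) * (k : ℝ) ^ (k * α₂)) := by
          rw [← Real.rpow_natCast (k : ℝ) k, ← Real.rpow_add hk', ← Real.rpow_sub hk']
          congr 1; ring
        have e2 : Real.exp (k * 2) = 1 / (Real.exp (-k) * Real.exp (-k)) := by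
          rw [← Real.exp_add, one_div, ← Real.exp_neg]; congr 1; ring
        rw [e1, e2]
        field_simp

/-- Coefficients of the approximants to `wright22 α₁ α₂`. -/
noncomputable def wrightApprox (α₁ α₂ : ℝ) (N k : ℕ) : ℝ :=
  1 / (k.factorial : ℝ) * mittagLefflerMoment α₁ N k * mittagLefflerMoment α₂ N k

theorem boundedOnNeg_wrightApprox {α₁ α₂ : ℝ} (h₁ : 0 ≤ α₁) (h₁' : α₁ ≤ 1) (h₂ : 0 ≤ α₂)
    (h₂' : α₂ ≤ 1) (N : ℕ) : BoundedOnNeg (wrightApprox α₁ α₂ N) := by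
  have h := (((boundedOnNeg_inv_factorial.mul_pow (l := (N : ℝ) ^ (1 - α₁))
    (by positivity)).mul_prod h₁ h₁' (N + 1)).mul_pow (l := (N : ℝ) ^ (1 - α₂))
    (by positivity)).mul_prod h₂ h₂' (N + 1)
  convert h using 2 with k
  rw [wrightApprox, mittagLefflerMoment, mittagLefflerMoment]
  ring

theorem tendsto_powSum_wrightApprox {α₁ α₂ : ℝ} (h₁ : 0 ≤ α₁) (h₁' : α₁ ≤ 1) (h₂ : 0 ≤ α₂)
    (h₂' : α₂ ≤ 1) (hsum : 1 < α₁ + α₂) (x : ℝ) :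
    Filter.Tendsto (fun N => powSum (wrightApprox α₁ α₂ N) x) Filter.atTop
      (nhds (wright22 α₁ α₂ x)) := by
  refine tendsto_tsum_of_dominated_convergence (summable_wright22 h₁ h₂ hsum (abs_nonneg x))
    (fun k => ?_) ?_
  · have h := ((tendsto_mittagLefflerMoment h₁ k).const_mul (1 / (k.factorial : ℝ))).mul
      (tendsto_mittagLefflerMoment h₂ k) |>.mul_const (x ^ k)
    have e : (k.factorial : ℝ) * x ^ k /
        (Real.Gamma (k * α₁ + 1) * Real.Gamma (k * α₂ + 1)) =
        1 / (k.factorial : ℝ) * (k.factorial / Real.Gamma (k * α₁ + 1)) *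
          (k.factorial / Real.Gamma (k * α₂ + 1)) * x ^ k := by
      have := Nat.factorial_ne_zero k
      field_simp
    rw [e]
    exact h
  · filter_upwards [Filter.eventually_gt_atTop 0] with N hN k
    have m₁ := mittagLefflerMoment_nonneg h₁ N k
    have m₂ := mittagLefflerMoment_nonneg h₂ N k
    have hG₁ : 0 < Real.Gamma (k * α₁ + 1) := Real.Gamma_pos_of_pos (by positivity)
    rw [wrightApprox, norm_mul, norm_pow, Real.norm_eq_abs x, Real.norm_of_nonneg (by positivity)]
    calc _ ≤ 1 / (k.factorial : ℝ) * (k.factorial / Real.Gamma (k * α₁ + 1)) *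
          (k.factorial / Real.Gamma (k * α₂ + 1)) * |x| ^ k := by
          gcongr
          · exact mittagLefflerMoment_le h₁ h₁' hN k
          · exact mittagLefflerMoment_le h₂ h₂' hN k
      _ = _ := by
          have := Nat.factorial_ne_zero k
          field_simp

/-- The truncated kernel `(1 - s / N) ^ N`, approximating `exp (-s)` on the positive half-line. -/
noncomputable def eulerKernel (N : ℕ) (s : ℝ) : ℝ := if s ≤ N then (1 - s / N) ^ N else 0

theorem eulerKernel_nonneg (N : ℕ) (s : ℝ) : 0 ≤ eulerKernel N s := by
  unfold eulerKernel
  split_ifs with h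
  · exact pow_nonneg (sub_nonneg.2 (div_le_one_of_le₀ h N.cast_nonneg)) _
  · exact le_rfl

theorem eulerKernel_le_exp_neg (N : ℕ) (s : ℝ) : eulerKernel N s ≤ Real.exp (-s) := by
  unfold eulerKernel
  split_ifs with h
  · exact Real.one_sub_div_pow_le_exp_neg h
  · exact (Real.exp_pos _).le

theorem measurable_eulerKernel (N : ℕ) : Measurable (eulerKernel N) :=
  Measurable.ite measurableSet_Iic (by fun_prop) measurable_const

theorem tendsto_eulerKernel (s : ℝ) :
    Filter.Tendsto (fun N => eulerKernel N s) Filter.atTop (nhds (Real.exp (-s))) := by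
  refine (Real.tendsto_one_add_div_pow_exp (-s)).congr' ?_
  filter_upwards [Filter.eventually_ge_atTop ⌈s⌉₊] with N hN
  rw [eulerKernel, if_pos (Nat.ceil_le.1 hN), neg_div, ← sub_eq_add_neg]

theorem integrable_eulerKernel_mul_rpow (N : ℕ) {a : ℝ} (ha : 0 ≤ a) :
    IntegrableOn (fun s => eulerKernel N s * s ^ a) (Set.Ioi 0) := by
  have h := Real.GammaIntegral_convergent (s := a + 1) (by positivity)
  simp only [add_sub_cancel_right] at h
  refine Integrable.mono' h (by
    exact ((measurable_eulerKernel N).mul (by fun_prop)).aestronglyMeasurable) ?_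
  refine ae_restrict_of_forall_mem measurableSet_Ioi fun s hs => ?_
  have hs' : 0 ≤ s ^ a := Real.rpow_nonneg (le_of_lt hs) a
  rw [Real.norm_of_nonneg (mul_nonneg (eulerKernel_nonneg N s) hs')]
  exact mul_le_mul_of_nonneg_right (eulerKernel_le_exp_neg N s) hs'

theorem integral_eulerKernel_mul_rpow {N : ℕ} (hN : 0 < N) {a : ℝ} (ha : 0 ≤ a) :
    ∫ s in Set.Ioi (0 : ℝ), eulerKernel N s * s ^ a = Real.GammaSeq (a + 1) N := by
  have h := Complex.GammaSeq_eq_approx_Gamma_integral (s := ((a + 1 : ℝ) : ℂ))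
    (by rw [Complex.ofReal_re]; positivity) hN.ne'
  have hseq : Complex.GammaSeq ((a + 1 : ℝ) : ℂ) N = (Real.GammaSeq (a + 1) N : ℂ) := by
    rw [Complex.GammaSeq, Real.GammaSeq]
    push_cast [Complex.ofReal_cpow N.cast_nonneg]
    rfl
  have hint : (∫ x : ℝ in (0 : ℝ)..N, (((1 - x / N) ^ N : ℝ) : ℂ) * (x : ℂ) ^ (((a + 1 : ℝ) : ℂ) - 1)) =
      ((∫ x : ℝ in (0 : ℝ)..N, (1 - x / N) ^ N * x ^ a : ℝ) : ℂ) := by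
    rw [← intervalIntegral.integral_ofReal]
    refine intervalIntegral.integral_congr fun x hx => ?_
    rw [Set.uIcc_of_le N.cast_nonneg] at hx
    rw [Complex.ofReal_mul, Complex.ofReal_cpow hx.1]
    push_cast
    congr 2
    ring
  rw [hseq, hint, Complex.ofReal_inj] at h
  rw [h, intervalIntegral.integral_of_le N.cast_nonneg, ← Set.Ioi_inter_Iic,
    ← setIntegral_indicator measurableSet_Iic]
  congr 1
  ext s
  simp only [eulerKernel, Set.indicator_apply, Set.mem_Iic, ite_mul, zero_mul]

theorem summable_gammaSeq_sq {N : ℕ} {r : ℝ} (hr : 0 ≤ r) :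
    Summable fun k : ℕ => 1 / (k.factorial : ℝ) * r ^ k *
      (Real.GammaSeq (k + 1) N * Real.GammaSeq (k + 1) N) := by
  have hG (k : ℕ) : Real.GammaSeq (k + 1) N ≤ (N : ℝ) ^ k * (N * N.factorial) := by
    rw [Real.GammaSeq, show (k : ℝ) + 1 = ((k + 1 : ℕ) : ℝ) by push_cast; rfl, Real.rpow_natCast,
      pow_succ, mul_assoc]
    refine div_le_self (by positivity) ?_
    refine Finset.one_le_prod fun j _ => ?_
    push_cast
    linarith [Nat.cast_nonneg (α := ℝ) k, Nat.cast_nonneg (α := ℝ) j]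
  have hG0 (k : ℕ) : 0 ≤ Real.GammaSeq (k + 1) N := by
    unfold Real.GammaSeq
    exact div_nonneg (by positivity) (Finset.prod_nonneg fun j _ => by positivity)
  refine Summable.of_nonneg_of_le (fun k => by have := hG0 k; positivity) (fun k => ?_)
    ((Real.summable_pow_div_factorial (r * N * N)).mul_right ((N * N.factorial) ^ 2 : ℝ))
  calc _ ≤ 1 / (k.factorial : ℝ) * r ^ k *
        (((N : ℝ) ^ k * (N * N.factorial)) * ((N : ℝ) ^ k * (N * N.factorial))) := by
        gcongr <;> first | exact hG0 k | exact hG k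
    _ = _ := by rw [mul_pow, mul_pow]; ring

/-- Termwise integration of a power series in `s₁ ^ α₁ * s₂ ^ α₂` against the truncated kernels. -/
theorem hasSum_integral_eulerKernel_mul_powSum {N : ℕ} (hN : 0 < N) {α₁ α₂ c : ℝ} (h₁ : 0 ≤ α₁)
    (h₂ : 0 ≤ α₂) (hc : 0 ≤ c) {a : ℕ → ℝ}
    (ha : Summable fun k : ℕ => |a k| * c ^ k *
      (Real.GammaSeq (α₂ * k + 1) N * Real.GammaSeq (α₁ * k + 1) N)) :
    HasSum (fun k : ℕ => a k * (-c) ^ k *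
        (Real.GammaSeq (α₂ * k + 1) N * Real.GammaSeq (α₁ * k + 1) N))
      (∫ z, eulerKernel N z.1 * eulerKernel N z.2 * powSum a (-(c * z.2 ^ α₁ * z.1 ^ α₂))
        ∂(volume.restrict (Set.Ioi (0 : ℝ))).prod (volume.restrict (Set.Ioi (0 : ℝ)))) := by
  have hcongr (α : ℝ) (k : ℕ) : Set.EqOn (fun s : ℝ => eulerKernel N s * s ^ (α * k))
      (fun s => eulerKernel N s * (s ^ α) ^ k) (Set.Ioi 0) := fun s hs => by
    simp only
    rw [Real.rpow_mul_natCast (le_of_lt hs)]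
  have hint (α : ℝ) (h : 0 ≤ α) (k : ℕ) : Integrable (fun s => eulerKernel N s * (s ^ α) ^ k)
      (volume.restrict (Set.Ioi 0)) :=
    IntegrableOn.congr_fun (integrable_eulerKernel_mul_rpow N (a := α * k) (by positivity))
      (hcongr α k) measurableSet_Ioi
  have hval (α : ℝ) (h : 0 ≤ α) (k : ℕ) : ∫ s in Set.Ioi (0 : ℝ), eulerKernel N s * (s ^ α) ^ k =
      Real.GammaSeq (α * k + 1) N := by
    rw [← integral_eulerKernel_mul_rpow hN (a := α * k) (by positivity)]
    exact (setIntegral_congr_fun measurableSet_Ioi (hcongr α k)).symm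
  have hnorm (α : ℝ) (h : 0 ≤ α) (k : ℕ) :
      ∫ s in Set.Ioi (0 : ℝ), ‖eulerKernel N s * (s ^ α) ^ k‖ = Real.GammaSeq (α * k + 1) N := by
    rw [← hval α h k]
    refine setIntegral_congr_fun measurableSet_Ioi fun s hs => Real.norm_of_nonneg ?_
    have : (0 : ℝ) ≤ s := le_of_lt hs
    have := eulerKernel_nonneg N s
    positivity
  have h := hasSum_integral_of_summable_integral_norm
    (μ := (volume.restrict (Set.Ioi (0 : ℝ))).prod (volume.restrict (Set.Ioi (0 : ℝ))))
    (F := fun (k : ℕ) z => a k * (-c) ^ k *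
      ((eulerKernel N z.1 * (z.1 ^ α₂) ^ k) * (eulerKernel N z.2 * (z.2 ^ α₁) ^ k)))
    (fun k => ((hint α₂ h₂ k).mul_prod (hint α₁ h₁ k)).const_mul _) (by
      refine ha.congr fun k => ?_
      simp only [norm_mul (a k * (-c) ^ k), norm_mul (eulerKernel N _ * _)]
      rw [integral_const_mul, integral_prod_mul (fun s => ‖eulerKernel N s * (s ^ α₂) ^ k‖)
        (fun s => ‖eulerKernel N s * (s ^ α₁) ^ k‖), hnorm α₂ h₂ k, hnorm α₁ h₁ k, norm_mul,
        norm_pow, norm_neg, Real.norm_of_nonneg hc, Real.norm_eq_abs])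
  have hF (z : ℝ × ℝ) :
      eulerKernel N z.1 * eulerKernel N z.2 * powSum a (-(c * z.2 ^ α₁ * z.1 ^ α₂)) =
      ∑' k : ℕ, a k * (-c) ^ k *
        ((eulerKernel N z.1 * (z.1 ^ α₂) ^ k) * (eulerKernel N z.2 * (z.2 ^ α₁) ^ k)) := by
    rw [powSum, ← tsum_mul_left]
    refine tsum_congr fun k => ?_
    rw [← neg_mul, ← neg_mul, mul_pow, mul_pow]; ring
  have hI (k : ℕ) : ∫ z : ℝ × ℝ, a k * (-c) ^ k *
        ((eulerKernel N z.1 * (z.1 ^ α₂) ^ k) * (eulerKernel N z.2 * (z.2 ^ α₁) ^ k))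
        ∂(volume.restrict (Set.Ioi (0 : ℝ))).prod (volume.restrict (Set.Ioi (0 : ℝ))) =
      a k * (-c) ^ k * (Real.GammaSeq (α₂ * k + 1) N * Real.GammaSeq (α₁ * k + 1) N) := by
    rw [integral_const_mul, integral_prod_mul (fun s => eulerKernel N s * (s ^ α₂) ^ k)
        (fun s => eulerKernel N s * (s ^ α₁) ^ k), hval α₂ h₂ k, hval α₁ h₁ k]
  simpa only [hF, hI] using h

/-- Passage to the limit in the truncated double Laplace transform. -/
theorem tendsto_integral_eulerKernel_mul_powSum {α₁ α₂ c : ℝ} (hc : 0 ≤ c) {a : ℕ → ℕ → ℝ}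
    {h : ℝ → ℝ} (ha : ∀ N, BoundedOnNeg (a N))
    (hlim : ∀ x, Filter.Tendsto (fun N => powSum (a N) x) Filter.atTop (nhds (h x))) :
    Filter.Tendsto (fun N => ∫ z, eulerKernel N z.1 * eulerKernel N z.2 *
        powSum (a N) (-(c * z.2 ^ α₁ * z.1 ^ α₂))
        ∂(volume.restrict (Set.Ioi (0 : ℝ))).prod (volume.restrict (Set.Ioi (0 : ℝ))))
      Filter.atTop (nhds (∫ t₂ in Set.Ioi (0 : ℝ), ∫ t₁ in Set.Ioi (0 : ℝ),
        Real.exp (-t₂) * Real.exp (-t₁) * h (-(c * t₁ ^ α₁ * t₂ ^ α₂)))) := by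
  set ν := (volume.restrict (Set.Ioi (0 : ℝ)))
  have hbd : Integrable (fun z : ℝ × ℝ => Real.exp (-z.1) * Real.exp (-z.2)) (ν.prod ν) :=
    (integrableOn_exp_neg_Ioi 0).mul_prod (integrableOn_exp_neg_Ioi 0)
  have hpos : ∀ᵐ z ∂ν.prod ν, 0 < z.1 ∧ 0 < z.2 := by
    rw [Measure.prod_restrict]
    exact ae_restrict_of_forall_mem (measurableSet_Ioi.prod measurableSet_Ioi) fun z hz => hz
  have hmeas : Measurable h :=
    measurable_of_tendsto_metrizable (fun N => (ha N).measurable_powSum) (tendsto_pi_nhds.2 hlim)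
  have hnonpos {z : ℝ × ℝ} (hz : 0 < z.1 ∧ 0 < z.2) : -(c * z.2 ^ α₁ * z.1 ^ α₂) ≤ 0 := by
    have := Real.rpow_nonneg hz.1.le α₂
    have := Real.rpow_nonneg hz.2.le α₁
    exact neg_nonpos.2 (by positivity)
  have hle {x : ℝ} (hx : x ≤ 0) : |h x| ≤ 1 :=
    le_of_tendsto (hlim x).abs (Filter.Eventually.of_forall fun N => (ha N).abs_powSum_le x hx)
  have harg : Measurable fun z : ℝ × ℝ => -(c * z.2 ^ α₁ * z.1 ^ α₂) := by fun_prop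
  have hint : Integrable (fun z : ℝ × ℝ =>
      Real.exp (-z.1) * Real.exp (-z.2) * h (-(c * z.2 ^ α₁ * z.1 ^ α₂))) (ν.prod ν) := by
    refine hbd.mono' ((Measurable.mul (by fun_prop) (hmeas.comp harg)).aestronglyMeasurable) ?_
    filter_upwards [hpos] with z hz
    rw [norm_mul, Real.norm_of_nonneg (by positivity)]
    exact mul_le_of_le_one_right (by positivity) (hle (hnonpos hz))
  have hprod := integral_prod _ hint
  simp only at hprod
  rw [← hprod]
  refine tendsto_integral_of_dominated_convergence _ (fun N => ?_) hbd (fun N => ?_) ?_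
  · exact ((((measurable_eulerKernel N).comp measurable_fst).mul
      ((measurable_eulerKernel N).comp measurable_snd)).mul
      ((ha N).measurable_powSum.comp harg)).aestronglyMeasurable
  · filter_upwards [hpos] with z hz
    have k₁ := eulerKernel_nonneg N z.1
    have k₂ := eulerKernel_nonneg N z.2
    rw [norm_mul, Real.norm_of_nonneg (by positivity)]
    refine (mul_le_of_le_one_right (by positivity) ((ha N).abs_powSum_le _ (hnonpos hz))).trans ?_
    gcongr <;> exact eulerKernel_le_exp_neg _ _
  · exact Filter.Eventually.of_forall fun z =>
      ((tendsto_eulerKernel z.1).mul (tendsto_eulerKernel z.2)).mul (hlim _)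

/-- The double Laplace transform identity at `z₁ = z₂ = 1`. -/
theorem integral_exp_neg_mul_wright22 {α₁ α₂ : ℝ} (h₁ : 0 ≤ α₁) (h₁' : α₁ ≤ 1) (h₂ : 0 ≤ α₂)
    (h₂' : α₂ ≤ 1) (hsum : 1 < α₁ + α₂) {c : ℝ} (hc : 0 ≤ c) :
    (∫ t₂ in Set.Ioi (0 : ℝ), ∫ t₁ in Set.Ioi (0 : ℝ),
        Real.exp (-t₂) * Real.exp (-t₁) * wright22 α₁ α₂ (-(c * t₁ ^ α₁ * t₂ ^ α₂)))
      = ∫ x₂ in Set.Ioi (0 : ℝ), ∫ x₁ in Set.Ioi (0 : ℝ),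
          Real.exp (-x₂) * Real.exp (-x₁) * Real.exp (-(c * x₁ * x₂)) := by
  have hR := tendsto_integral_eulerKernel_mul_powSum (α₁ := 1) (α₂ := 1) hc
    (fun _ => boundedOnNeg_inv_factorial) (fun x => by
      simpa only [powSum_inv_factorial] using tendsto_const_nhds)
  simp only [Real.rpow_one] at hR
  refine tendsto_nhds_unique (tendsto_integral_eulerKernel_mul_powSum hc
    (boundedOnNeg_wrightApprox h₁ h₁' h₂ h₂')
    (tendsto_powSum_wrightApprox h₁ h₁' h₂ h₂' hsum)) (hR.congr' ?_)
  filter_upwards [Filter.eventually_gt_atTop 0] with N hN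
  have key (k : ℕ) : wrightApprox α₁ α₂ N k *
      (Real.GammaSeq (α₂ * k + 1) N * Real.GammaSeq (α₁ * k + 1) N) =
      1 / (k.factorial : ℝ) * (Real.GammaSeq (k + 1) N * Real.GammaSeq (k + 1) N) := by
    rw [wrightApprox, ← mittagLefflerMoment_mul_gammaSeq h₁ hN k]
    nth_rw 2 [mittagLefflerMoment_mul_gammaSeq h₁ hN k]
    rw [← mittagLefflerMoment_mul_gammaSeq h₂ hN k]
    ring
  have hw (k : ℕ) : 0 ≤ wrightApprox α₁ α₂ N k :=
    mul_nonneg (mul_nonneg (by positivity) (mittagLefflerMoment_nonneg h₁ N k))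
      (mittagLefflerMoment_nonneg h₂ N k)
  have hL := hasSum_integral_eulerKernel_mul_powSum hN h₁ h₂ hc (a := wrightApprox α₁ α₂ N) (by
    refine (summable_gammaSeq_sq (N := N) hc).congr fun k => ?_
    rw [abs_of_nonneg (hw k)]
    linear_combination -(c ^ k) * key k)
  have hE := hasSum_integral_eulerKernel_mul_powSum hN zero_le_one zero_le_one hc
    (a := fun k => 1 / (k.factorial : ℝ)) (by
      simpa only [one_mul, abs_of_nonneg (show (0 : ℝ) ≤ 1 / (Nat.factorial _ : ℝ) by positivity)]
        using summable_gammaSeq_sq (N := N) hc)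
  simp only [Real.rpow_one, one_mul] at hE
  refine hE.unique ?_
  rw [show (fun k : ℕ => 1 / (k.factorial : ℝ) * (-c) ^ k *
      (Real.GammaSeq (k + 1) N * Real.GammaSeq (k + 1) N)) = fun k : ℕ =>
      wrightApprox α₁ α₂ N k * (-c) ^ k *
        (Real.GammaSeq (α₂ * k + 1) N * Real.GammaSeq (α₁ * k + 1) N) from
    funext fun k => by linear_combination -((-c) ^ k) * key k]
  exact hL

/-- Double Laplace transform of `W_c(t₁,t₂) = Σ_k k! (-c t₁^{α₁}t₂^{α₂})ᵏ/(Γ(kα₁+1)Γ(kα₂+1))`: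
`∫₀^∞∫₀^∞ e^{-z₁t₁-z₂t₂} W_c dt₁ dt₂
  = z₁^{α₁-1} z₂^{α₂-1} ∫₀^∞∫₀^∞ e^{-cx₁x₂ - z₁^{α₁}x₁ - z₂^{α₂}x₂} dx₁ dx₂`. -/
theorem stmt7 (α₁ α₂ : ℝ) (hα₁ : 0 < α₁) (hα₁' : α₁ < 1) (hα₂ : 0 < α₂) (hα₂' : α₂ < 1)
    (hsum : 1 < α₁ + α₂) (c : ℝ) (hc : 0 ≤ c) (z₁ z₂ : ℝ) (hz₁ : 0 < z₁) (hz₂ : 0 < z₂) :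
    (∫ t₂ in Set.Ioi (0 : ℝ), ∫ t₁ in Set.Ioi (0 : ℝ),
        Real.exp (-(z₁ * t₁) - z₂ * t₂) * wright22 α₁ α₂ (-(c * t₁ ^ α₁ * t₂ ^ α₂)))
      = z₁ ^ (α₁ - 1) * z₂ ^ (α₂ - 1) *
        ∫ x₂ in Set.Ioi (0 : ℝ), ∫ x₁ in Set.Ioi (0 : ℝ),
          Real.exp (-(c * x₁ * x₂) - z₁ ^ α₁ * x₁ - z₂ ^ α₂ * x₂) := by
  have scale (g : ℝ → ℝ → ℝ) {b₁ b₂ : ℝ} (hb₁ : 0 < b₁) (hb₂ : 0 < b₂) :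
      (∫ t₂ in Set.Ioi (0 : ℝ), ∫ t₁ in Set.Ioi (0 : ℝ), g (b₁ * t₁) (b₂ * t₂)) =
        b₁⁻¹ * b₂⁻¹ * ∫ t₂ in Set.Ioi (0 : ℝ), ∫ t₁ in Set.Ioi (0 : ℝ), g t₁ t₂ := by
    have h₁ (y : ℝ) := integral_comp_mul_left_Ioi (fun x => g x y) 0 hb₁
    have h₂ := integral_comp_mul_left_Ioi (fun y => ∫ x in Set.Ioi (0 : ℝ), g x y) 0 hb₂
    simp only [mul_zero, smul_eq_mul] at h₁ h₂
    simp only [h₁, integral_const_mul, h₂, mul_assoc]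
  have p₁ : 0 < z₁ ^ α₁ := Real.rpow_pos_of_pos hz₁ _
  have p₂ : 0 < z₂ ^ α₂ := Real.rpow_pos_of_pos hz₂ _
  have key := integral_exp_neg_mul_wright22 hα₁.le hα₁'.le hα₂.le hα₂'.le hsum
    (c := c * (z₁ ^ α₁)⁻¹ * (z₂ ^ α₂)⁻¹) (by positivity)
  have hL := scale (fun t₁ t₂ => Real.exp (-t₂) * Real.exp (-t₁) *
    wright22 α₁ α₂ (-(c * (z₁ ^ α₁)⁻¹ * (z₂ ^ α₂)⁻¹ * t₁ ^ α₁ * t₂ ^ α₂))) hz₁ hz₂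
  have hR := scale (fun x₁ x₂ => Real.exp (-x₂) * Real.exp (-x₁) *
    Real.exp (-(c * (z₁ ^ α₁)⁻¹ * (z₂ ^ α₂)⁻¹ * x₁ * x₂))) p₁ p₂
  have hR' : (∫ x₂ in Set.Ioi (0 : ℝ), ∫ x₁ in Set.Ioi (0 : ℝ),
      Real.exp (-(c * x₁ * x₂) - z₁ ^ α₁ * x₁ - z₂ ^ α₂ * x₂)) =
      ∫ x₂ in Set.Ioi (0 : ℝ), ∫ x₁ in Set.Ioi (0 : ℝ),
        Real.exp (-(z₂ ^ α₂ * x₂)) * Real.exp (-(z₁ ^ α₁ * x₁)) *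
        Real.exp (-(c * (z₁ ^ α₁)⁻¹ * (z₂ ^ α₂)⁻¹ * (z₁ ^ α₁ * x₁) * (z₂ ^ α₂ * x₂))) := by
    congr! 4 with x₂ x₁
    rw [← Real.exp_add, ← Real.exp_add]
    congr 1
    field_simp
    ring
  have hL' : (∫ t₂ in Set.Ioi (0 : ℝ), ∫ t₁ in Set.Ioi (0 : ℝ),
      Real.exp (-(z₁ * t₁) - z₂ * t₂) * wright22 α₁ α₂ (-(c * t₁ ^ α₁ * t₂ ^ α₂))) =
      ∫ t₂ in Set.Ioi (0 : ℝ), ∫ t₁ in Set.Ioi (0 : ℝ),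
        Real.exp (-(z₂ * t₂)) * Real.exp (-(z₁ * t₁)) * wright22 α₁ α₂
          (-(c * (z₁ ^ α₁)⁻¹ * (z₂ ^ α₂)⁻¹ * (z₁ * t₁) ^ α₁ * (z₂ * t₂) ^ α₂)) := by
    refine setIntegral_congr_fun measurableSet_Ioi fun t₂ ht₂ =>
      setIntegral_congr_fun measurableSet_Ioi fun t₁ ht₁ => ?_
    rw [← Real.exp_add, Real.mul_rpow hz₁.le (le_of_lt ht₁), Real.mul_rpow hz₂.le (le_of_lt ht₂)]
    congr 2
    · ring
    · field_simp
  rw [hL', hR', hL, hR, key, Real.rpow_sub_one hz₁.ne', Real.rpow_sub_one hz₂.ne']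
  rw [← mul_assoc]
  congr 1
  field_simp
end

section
/- Let λ > 0 and σ > 0. Define, for y > 0 and t₁, t₂ ≥ 0, f(y, t₁, t₂) = (e^{−σy − λ t₁ t₂}/y) Σ_{n=1}^∞ (λσ t₁ t₂ y)ⁿ/((n−1)! n!). Then f satisfies the partial differential equation σ ∂f/∂t₁ (y, t₁, t₂) = − λ t₂ ∂f/∂y (y, t₁, t₂) − ∂²f/∂t₁∂y (y, t₁, t₂) for all y > 0, t₁ ≥ 0, t₂ ≥ 0, with f(y, 0, t₂) = 0; and symmetrically σ ∂f/∂t₂ = − λ t₁ ∂f/∂y − ∂²f/∂t₂∂y, with f(y, t₁, 0) = 0. -/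
/-- The absolutely continuous part of the distribution of the compound Poisson random
field with exponential compounding:
`f(y,t₁,t₂) = (e^{-σy-λt₁t₂}/y) Σ_{n≥1} (λσt₁t₂y)ⁿ/((n-1)!n!)`
(the sum over `n ≥ 1` is written with `n = m+1`, `m ∈ ℕ`). -/
noncomputable def fCPRF (lam σ : ℝ) (y t₁ t₂ : ℝ) : ℝ :=
  (Real.exp (-(σ * y) - lam * t₁ * t₂) / y) *
    ∑' m : ℕ, (lam * σ * t₁ * t₂ * y) ^ (m + 1) / ((m.factorial : ℝ) * ((m + 1).factorial : ℝ))

/-- The Bessel-type entire series `Σ_m x^m / (m! (m+k)!)`. -/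
noncomputable def besselSeries (k : ℕ) (x : ℝ) : ℝ :=
  ∑' m : ℕ, x ^ m / ((m.factorial : ℝ) * ((m + k).factorial : ℝ))

lemma summable_besselSeries (k : ℕ) (x : ℝ) :
    Summable fun m : ℕ => x ^ m / ((m.factorial : ℝ) * ((m + k).factorial : ℝ)) := by
  refine Summable.of_norm_bounded (Real.summable_pow_div_factorial |x|) fun m => ?_
  have h1 : (0 : ℝ) < m.factorial := by positivity
  have h2 : (1 : ℝ) ≤ (m + k).factorial := by exact_mod_cast (m + k).factorial_pos
  rw [norm_div, norm_pow, Real.norm_eq_abs, Real.norm_of_nonneg (by positivity)]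
  gcongr
  exact le_mul_of_one_le_right h1.le h2

lemma natCast_succ_mul_pow_div_factorial (k m : ℕ) (x : ℝ) :
    ((m + 1 : ℕ) : ℝ) * x ^ m / (((m + 1).factorial : ℝ) * ((m + 1 + k).factorial : ℝ)) =
      x ^ m / ((m.factorial : ℝ) * ((m + (k + 1)).factorial : ℝ)) := by
  have h1 : (m.factorial : ℝ) ≠ 0 := by positivity
  have h2 : ((m + (k + 1)).factorial : ℝ) ≠ 0 := by positivity
  rw [show m + 1 + k = m + (k + 1) by ring, Nat.factorial_succ]
  push_cast
  field_simp

lemma summable_deriv_besselSeries (k : ℕ) (x : ℝ) :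
    Summable fun m : ℕ =>
      (m : ℝ) * x ^ (m - 1) / ((m.factorial : ℝ) * ((m + k).factorial : ℝ)) := by
  rw [← summable_nat_add_iff 1]
  simp only [Nat.add_sub_cancel, natCast_succ_mul_pow_div_factorial]
  exact summable_besselSeries (k + 1) x

lemma tsum_deriv_besselSeries (k : ℕ) (x : ℝ) :
    ∑' m : ℕ, (m : ℝ) * x ^ (m - 1) / ((m.factorial : ℝ) * ((m + k).factorial : ℝ)) =
      besselSeries (k + 1) x := by
  rw [(summable_deriv_besselSeries k x).tsum_eq_zero_add]
  simp only [Nat.add_sub_cancel, natCast_succ_mul_pow_div_factorial]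
  simp [besselSeries]

lemma hasDerivAt_besselSeries (k : ℕ) (x : ℝ) :
    HasDerivAt (besselSeries k) (besselSeries (k + 1) x) x := by
  rw [← tsum_deriv_besselSeries]
  have hx : x ∈ Metric.ball (0 : ℝ) (|x| + 1) := by simp
  refine hasDerivAt_tsum_of_isPreconnected (summable_deriv_besselSeries k (|x| + 1))
    Metric.isOpen_ball (convex_ball _ _).isPreconnected
    (fun m z _ => (hasDerivAt_pow m z).div_const _) (fun m z hz => ?_) hx
    (summable_besselSeries k x) hx
  have hz' : |z| ≤ |x| + 1 := by simpa using (Metric.mem_ball.1 hz).le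
  rw [norm_div, norm_mul, norm_pow, Real.norm_eq_abs z, Real.norm_of_nonneg (by positivity),
    Real.norm_of_nonneg (by positivity)]
  gcongr

lemma besselSeries_recurrence (k : ℕ) (x : ℝ) :
    x * besselSeries (k + 2) x + (k + 1) * besselSeries (k + 1) x = besselSeries k x := by
  rw [← tsum_deriv_besselSeries (k + 1) x, besselSeries, besselSeries, ← tsum_mul_left,
    ← tsum_mul_left, ← ((summable_deriv_besselSeries (k + 1) x).mul_left x).tsum_add
      ((summable_besselSeries (k + 1) x).mul_left _)]
  refine tsum_congr fun m => ?_
  have h1 : (m.factorial : ℝ) ≠ 0 := by positivity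
  have h2 : ((m + k).factorial : ℝ) ≠ 0 := by positivity
  have h3 : x * (m * x ^ (m - 1)) = m * x ^ m := by
    cases m with
    | zero => simp
    | succ n => simp only [Nat.add_sub_cancel]; ring
  have h4 : (m : ℝ) + k + 1 ≠ 0 := by positivity
  rw [← mul_div_assoc, h3, ← add_assoc m k 1, Nat.factorial_succ]
  push_cast
  field_simp
  ring

lemma fCPRF_comm (lam σ y t₁ t₂ : ℝ) : fCPRF lam σ y t₁ t₂ = fCPRF lam σ y t₂ t₁ := by
  simp only [fCPRF, mul_assoc, mul_comm t₁ t₂]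

lemma fCPRF_zero_left (lam σ y t₂ : ℝ) : fCPRF lam σ y 0 t₂ = 0 := by
  simp [fCPRF]

lemma fCPRF_eq_besselSeries (lam σ : ℝ) {y : ℝ} (hy : y ≠ 0) (r t : ℝ) :
    fCPRF lam σ y r t = Real.exp (-(σ * y) - lam * r * t) *
      (lam * σ * r * t * besselSeries 1 (lam * σ * r * t * y)) := by
  simp only [fCPRF, besselSeries, pow_succ', mul_div_assoc, tsum_mul_left]
  field_simp

lemma hasDerivAt_fCPRF_left (lam σ : ℝ) {y : ℝ} (hy : y ≠ 0) (r t : ℝ) :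
    HasDerivAt (fun y' => fCPRF lam σ y' r t)
      (Real.exp (-(σ * y) - lam * r * t) * (lam * σ * r * t *
        (lam * σ * r * t * besselSeries 2 (lam * σ * r * t * y)
          - σ * besselSeries 1 (lam * σ * r * t * y)))) y := by
  have hE : HasDerivAt (fun y' => Real.exp (-(σ * y') - lam * r * t))
      (Real.exp (-(σ * y) - lam * r * t) * (-(σ * 1))) y :=
    ((((hasDerivAt_id y).const_mul σ).neg).sub_const (lam * r * t)).exp
  have hB : HasDerivAt (fun y' => besselSeries 1 (lam * σ * r * t * y'))
      (besselSeries 2 (lam * σ * r * t * y) * (lam * σ * r * t * 1)) y :=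
    (hasDerivAt_besselSeries 1 _).comp y ((hasDerivAt_id y).const_mul (lam * σ * r * t))
  refine ((hE.mul (hB.const_mul (lam * σ * r * t))).congr_of_eventuallyEq ?_).congr_deriv
    (by ring)
  filter_upwards [isOpen_ne.mem_nhds hy] with z hz
  exact fCPRF_eq_besselSeries lam σ hz r t

lemma fCPRF_pde (lam σ : ℝ) {y : ℝ} (hy : y ≠ 0) (r t : ℝ) :
    σ * deriv (fun r => fCPRF lam σ y r t) r
      = -(lam * t) * deriv (fun y' => fCPRF lam σ y' r t) y
        - deriv (fun r => deriv (fun y' => fCPRF lam σ y' r t) y) r := by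
  have hE : HasDerivAt (fun r => Real.exp (-(σ * y) - lam * r * t))
      (Real.exp (-(σ * y) - lam * r * t) * (-(lam * 1 * t))) r :=
    ((((hasDerivAt_id r).const_mul lam).mul_const t).const_sub (-(σ * y))).exp
  have hL : HasDerivAt (fun r => lam * σ * r * t) (lam * σ * 1 * t) r :=
    ((hasDerivAt_id r).const_mul (lam * σ)).mul_const t
  have hB (k : ℕ) : HasDerivAt (fun r => besselSeries k (lam * σ * r * t * y))
      (besselSeries (k + 1) (lam * σ * r * t * y) * (lam * σ * 1 * t * y)) r :=
    (hasDerivAt_besselSeries k _).comp r (hL.mul_const y)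
  have h1 := hE.mul (hL.mul (hB 1))
  have h2 := hE.mul (hL.mul ((hL.mul (hB 2)).sub ((hB 1).const_mul σ)))
  have e1 : (fun r => fCPRF lam σ y r t) = _ :=
    funext fun r => fCPRF_eq_besselSeries lam σ hy r t
  have e2 : (fun r => deriv (fun y' => fCPRF lam σ y' r t) y) = _ :=
    funext fun r => (hasDerivAt_fCPRF_left lam σ hy r t).deriv
  rw [e2, (hasDerivAt_fCPRF_left lam σ hy r t).deriv, e1]
  refine (congrArg (σ * ·) h1.deriv).trans (Eq.trans ?_ (congrArg (_ - ·) h2.deriv).symm)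
  have hrec := besselSeries_recurrence 1 (lam * σ * r * t * y)
  norm_num at hrec ⊢
  rw [← hrec]
  ring

/-- `f` solves `σ ∂f/∂t₁ = -λt₂ ∂f/∂y - ∂²f/∂t₁∂y` with `f(y,0,t₂) = 0`, and symmetrically
`σ ∂f/∂t₂ = -λt₁ ∂f/∂y - ∂²f/∂t₂∂y` with `f(y,t₁,0) = 0`. -/
theorem stmt10 (lam σ : ℝ) (hlam : 0 < lam) (hσ : 0 < σ) (y t₁ t₂ : ℝ)
    (hy : 0 < y) (ht₁ : 0 ≤ t₁) (ht₂ : 0 ≤ t₂) :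
    (σ * deriv (fun r => fCPRF lam σ y r t₂) t₁
        = -(lam * t₂) * deriv (fun y' => fCPRF lam σ y' t₁ t₂) y
          - deriv (fun r => deriv (fun y' => fCPRF lam σ y' r t₂) y) t₁)
    ∧ fCPRF lam σ y 0 t₂ = 0
    ∧ (σ * deriv (fun s => fCPRF lam σ y t₁ s) t₂
        = -(lam * t₁) * deriv (fun y' => fCPRF lam σ y' t₁ t₂) y
          - deriv (fun s => deriv (fun y' => fCPRF lam σ y' t₁ s) y) t₂)
    ∧ fCPRF lam σ y t₁ 0 = 0 := by
  refine ⟨fCPRF_pde lam σ hy.ne' t₁ t₂, fCPRF_zero_left lam σ y t₂, ?_, ?_⟩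
  · simp only [fCPRF_comm lam σ _ t₁]
    exact fCPRF_pde lam σ hy.ne' t₂ t₁
  · rw [fCPRF_comm, fCPRF_zero_left]
end

section
/- Let 0 < α ≤ 1 and 0 ≤ u < 1. Define, for λ > 0 and t₁, t₂ ≥ 0, G(u, t₁, t₂; λ) = exp( − t₁ t₂ λ^α (1−u)^α ). Then G satisfies the partial differential equation ∂²G/∂t₂∂t₁ (u, t₁, t₂; λ) = − (λ^{α+1}/α) (1−u)^α ∂G/∂λ (u, t₁, t₂; λ) − λ^α (1−u)^α G(u, t₁, t₂; λ) for all λ > 0, t₁ ≥ 0, t₂ ≥ 0. -/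
/-- The mixed second derivative of `(r, s) ↦ exp (-(r * s * a * b))`. -/
theorem deriv_deriv_exp_neg_mul (a b t₁ t₂ : ℝ) :
    deriv (fun s => deriv (fun r => Real.exp (-(r * s * a * b))) t₁) t₂
      = (t₁ * t₂ * (a * b) ^ 2 - a * b) * Real.exp (-(t₁ * t₂ * a * b)) := by
  have inner_deriv : (fun s => deriv (fun r => Real.exp (-(r * s * a * b))) t₁)
      = fun s => Real.exp (-(t₁ * s * a * b)) * -(1 * s * a * b) := by
    funext s
    exact (((((hasDerivAt_id' t₁).mul_const s).mul_const a).mul_const b).fun_neg.exp).deriv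
  rw [inner_deriv]
  have h_exp := ((((hasDerivAt_id' t₂).const_mul t₁).mul_const a).mul_const b).fun_neg.exp
  have h_lin := ((((hasDerivAt_id' t₂).const_mul 1).mul_const a).mul_const b).fun_neg
  rw [(h_exp.fun_mul h_lin).deriv]
  ring

/-- The probability generating function `G(u,t₁,t₂;λ) = exp(-t₁t₂λ^α(1-u)^α)` of the
space fractional Poisson random field satisfies
`∂²G/∂t₂∂t₁ = -(λ^{α+1}/α)(1-u)^α ∂G/∂λ - λ^α(1-u)^α G`. -/
theorem stmt14 (α : ℝ) (hα : 0 < α) (hα1 : α ≤ 1) (u : ℝ) (hu0 : 0 ≤ u) (hu1 : u < 1)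
    (lam t₁ t₂ : ℝ) (hlam : 0 < lam) (ht₁ : 0 ≤ t₁) (ht₂ : 0 ≤ t₂) :
    deriv (fun s => deriv (fun r => Real.exp (-(r * s * lam ^ α * (1 - u) ^ α))) t₁) t₂
      = -(lam ^ (α + 1) / α) * (1 - u) ^ α
          * deriv (fun l => Real.exp (-(t₁ * t₂ * l ^ α * (1 - u) ^ α))) lam
        - lam ^ α * (1 - u) ^ α * Real.exp (-(t₁ * t₂ * lam ^ α * (1 - u) ^ α)) := by
  have h_lam := ((((Real.hasDerivAt_rpow_const (p := α) (Or.inl hlam.ne')).const_mul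
    (t₁ * t₂)).mul_const ((1 - u) ^ α)).fun_neg.exp).deriv
  rw [deriv_deriv_exp_neg_mul, h_lam, Real.rpow_add_one hlam.ne', Real.rpow_sub_one hlam.ne']
  field_simp
end

section
/- Let α₁, α₂ ∈ (0,1] with α₁ + α₂ > 1, let λ > 0, t₁ ≥ 0, t₂ ≥ 0, and let p_{α₁,α₂}(n) = Σ_{k=n}^∞ (−1)^{k−n} (k)_{k−n} (k)_n (λ t₁^{α₁} t₂^{α₂})ᵏ / ( Γ(kα₁+1) Γ(kα₂+1) ) for integers n ≥ 0, where (k)_n = k!/(k−n)! and (k)_{k−n} = k!/n!. Then for every u > 0, Σ_{n=0}^∞ e^{−un} p_{α₁,α₂}(n) = Σ_{k=0}^∞ k! ( − λ t₁^{α₁} t₂^{α₂} (1 − e^{−u}) )ᵏ / ( Γ(kα₁+1) Γ(kα₂+1) ). -/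
/-- One-dimensional distribution of the time fractional Poisson random field:
`p_{α₁,α₂}(n) = Σ_{k=n}^∞ (-1)^{k-n} (k)_{k-n} (k)_n (λt₁^{α₁}t₂^{α₂})ᵏ/(Γ(kα₁+1)Γ(kα₂+1))`,
where `(k)_n = k!/(k-n)!` is the falling factorial (`Nat.descFactorial`). -/
noncomputable def pTF (α₁ α₂ lam t₁ t₂ : ℝ) (n : ℕ) : ℝ :=
  ∑' k : ℕ, if n ≤ k then
      (-1 : ℝ) ^ (k - n) * (k.descFactorial (k - n) : ℝ) * (k.descFactorial n : ℝ)
        * (lam * t₁ ^ α₁ * t₂ ^ α₂) ^ k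
        / (Real.Gamma ((k : ℝ) * α₁ + 1) * Real.Gamma ((k : ℝ) * α₂ + 1))
    else 0

theorem Real.rpow_mul_Gamma_add_one_le_Gamma_add {x a : ℝ} (hx : 0 < x) (ha : 0 < a) :
    x ^ a * Real.Gamma (x + 1) ≤ Real.Gamma (x + 1 + a) := by
  have h := Real.convexOn_log_Gamma.slope_mono_adjacent (x := x) (y := x + 1) (z := x + 1 + a)
    (Set.mem_Ioi.2 hx) (Set.mem_Ioi.2 (by linarith)) (by linarith) (by linarith)
  have hΓ := Real.Gamma_pos_of_pos hx
  have hΓ₁ : 0 < Real.Gamma (x + 1) := Real.Gamma_pos_of_pos (by linarith)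
  have hΓ₂ : 0 < Real.Gamma (x + 1 + a) := Real.Gamma_pos_of_pos (by linarith)
  have hlog : Real.log (Real.Gamma (x + 1)) = Real.log x + Real.log (Real.Gamma x) := by
    rw [Real.Gamma_add_one hx.ne', Real.log_mul hx.ne' hΓ.ne']
  simp only [Function.comp_apply, add_sub_cancel_left, div_one, le_div_iff₀ ha] at h
  rw [← Real.log_le_log_iff (by positivity) hΓ₂, Real.log_mul (by positivity) hΓ₁.ne',
    Real.log_rpow hx]
  nlinarith

open Filter Topology in
/-- The generalized Wright function `₂Ψ₂[(1,1),(1,1);(1,a),(1,b) | y]` converges for all `y`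
when `a + b > 1`. -/
theorem summable_factorial_mul_pow_div_Gamma_mul_Gamma {a b : ℝ} (ha : 0 < a) (hb : 0 < b)
    (hab : 1 < a + b) (y : ℝ) :
    Summable fun k : ℕ => (k.factorial : ℝ) * y ^ k
      / (Real.Gamma ((k : ℝ) * a + 1) * Real.Gamma ((k : ℝ) * b + 1)) := by
  have hΓ (c : ℝ) (hc : 0 < c) (k : ℕ) : 0 < Real.Gamma ((k : ℝ) * c + 1) :=
    Real.Gamma_pos_of_pos (by positivity)
  have hlim : Tendsto (fun k : ℕ => 2 * |y| / (a ^ a * b ^ b) * (k : ℝ) ^ (-(a + b - 1)))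
      atTop (𝓝 0) := by
    simpa using ((tendsto_rpow_neg_atTop (by linarith : 0 < a + b - 1)).comp
      tendsto_natCast_atTop_atTop).const_mul (2 * |y| / (a ^ a * b ^ b))
  refine summable_of_ratio_norm_eventually_le (r := 1 / 2) (by norm_num) ?_
  filter_upwards [hlim.eventually_le_const (by norm_num : (0 : ℝ) < 1 / 2), eventually_ge_atTop 1]
    with k hk hk1
  have hk0 : (0 : ℝ) < k := by exact_mod_cast hk1
  have hk1' : (1 : ℝ) ≤ k := by exact_mod_cast hk1
  have step (c : ℝ) (hc : 0 < c) : (k : ℝ) ^ c * c ^ c * Real.Gamma (k * c + 1)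
      ≤ Real.Gamma (((k + 1 : ℕ) : ℝ) * c + 1) := by
    rw [← Real.mul_rpow hk0.le hc.le]
    convert Real.rpow_mul_Gamma_add_one_le_Gamma_add (mul_pos hk0 hc) hc using 2
    push_cast; ring
  have hpow : (k : ℝ) ^ (-(a + b - 1)) = k / (k ^ a * k ^ b) := by
    rw [← Real.rpow_add hk0, neg_sub, Real.rpow_sub hk0, Real.rpow_one]
  simp only [norm_div, norm_mul, norm_pow, Real.norm_eq_abs, Nat.abs_cast,
    abs_of_pos (hΓ _ ha _), abs_of_pos (hΓ _ hb _)]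
  have hA := hΓ a ha k
  have hB := hΓ b hb k
  calc _ ≤ ((k + 1).factorial : ℝ) * |y| ^ (k + 1)
        / (((k : ℝ) ^ a * a ^ a * Real.Gamma (k * a + 1))
          * ((k : ℝ) ^ b * b ^ b * Real.Gamma (k * b + 1))) := by
        gcongr
        · exact step a ha
        · exact step b hb
    _ = (((k : ℝ) + 1) * |y| / (a ^ a * b ^ b) / (k ^ a * k ^ b)) * ((k.factorial : ℝ) * |y| ^ k
          / (Real.Gamma (k * a + 1) * Real.Gamma (k * b + 1))) := by
        rw [Nat.factorial_succ, pow_succ |y|]; push_cast; field_simp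
    _ ≤ _ := by
        refine mul_le_mul_of_nonneg_right (le_trans ?_ hk) (by positivity)
        rw [hpow, mul_div_assoc', mul_comm _ (k : ℝ), ← mul_div_assoc]
        gcongr ?_ / _ / _
        nlinarith [abs_nonneg y]

theorem summable_mul_choose_mul_pow {A : ℕ → ℝ} {r s : ℝ}
    (hA : Summable fun k => ‖A k‖ * (‖r‖ + ‖s‖) ^ k) :
    Summable fun p : ℕ × ℕ => A p.1 * (r ^ p.2 * s ^ (p.1 - p.2) * (p.1.choose p.2 : ℝ)) := by
  have hsupp (k n : ℕ) (hn : n ∉ Finset.range (k + 1)) :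
      ‖A k * (r ^ n * s ^ (k - n) * (k.choose n : ℝ))‖ = 0 := by
    rw [Nat.choose_eq_zero_of_lt (by simpa using hn)]; simp
  refine Summable.of_norm ((summable_prod_of_nonneg fun _ => norm_nonneg _).2
    ⟨fun k => summable_of_ne_finset_zero (hsupp k), hA.congr fun k => ?_⟩)
  rw [tsum_eq_sum (hsupp k), add_pow, Finset.mul_sum]
  simp

theorem tsum_mul_choose_mul_pow (c : ℝ) (r s : ℝ) (k : ℕ) :
    ∑' n : ℕ, c * (r ^ n * s ^ (k - n) * (k.choose n : ℝ)) = c * (r + s) ^ k := by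
  rw [tsum_eq_sum (s := Finset.range (k + 1)), add_pow, Finset.mul_sum]
  intro n hn
  rw [Nat.choose_eq_zero_of_lt (by simpa using hn)]; simp

theorem Nat.descFactorial_sub_mul_descFactorial {n k : ℕ} (h : n ≤ k) :
    k.descFactorial (k - n) * k.descFactorial n = k.factorial * k.choose n := by
  rw [Nat.descFactorial_eq_factorial_mul_choose k n, ← mul_assoc, mul_comm _ n.factorial,
    ← Nat.factorial_mul_descFactorial (Nat.sub_le k n), Nat.sub_sub_self h]

/-- The Laplace transform of the time fractional Poisson random field equals the
generalized Wright function: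
`Σ_{n=0}^∞ e^{-un} p_{α₁,α₂}(n)
  = Σ_{k=0}^∞ k! (-λt₁^{α₁}t₂^{α₂}(1-e^{-u}))ᵏ/(Γ(kα₁+1)Γ(kα₂+1))`. -/
theorem stmt16 (α₁ α₂ : ℝ) (hα₁ : 0 < α₁) (hα₁' : α₁ ≤ 1) (hα₂ : 0 < α₂) (hα₂' : α₂ ≤ 1)
    (hsum : 1 < α₁ + α₂) (lam t₁ t₂ : ℝ) (hlam : 0 < lam) (ht₁ : 0 ≤ t₁) (ht₂ : 0 ≤ t₂)
    (u : ℝ) (hu : 0 < u) :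
    ∑' n : ℕ, Real.exp (-(u * n)) * pTF α₁ α₂ lam t₁ t₂ n
      = ∑' k : ℕ, (k.factorial : ℝ)
          * (-(lam * t₁ ^ α₁ * t₂ ^ α₂ * (1 - Real.exp (-u)))) ^ k
          / (Real.Gamma ((k : ℝ) * α₁ + 1) * Real.Gamma ((k : ℝ) * α₂ + 1)) := by
  set x := lam * t₁ ^ α₁ * t₂ ^ α₂ with hx
  set A : ℕ → ℝ := fun k => (k.factorial : ℝ) * x ^ k
    / (Real.Gamma ((k : ℝ) * α₁ + 1) * Real.Gamma ((k : ℝ) * α₂ + 1)) with hA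
  have hterm (n : ℕ) : Real.exp (-(u * n)) * pTF α₁ α₂ lam t₁ t₂ n
      = ∑' k : ℕ, A k * (Real.exp (-u) ^ n * (-1) ^ (k - n) * (k.choose n : ℝ)) := by
    rw [pTF, ← tsum_mul_left]
    refine tsum_congr fun k => ?_
    split_ifs with h
    · have hc : (k.descFactorial (k - n) : ℝ) * k.descFactorial n = k.factorial * k.choose n := by
        exact_mod_cast Nat.descFactorial_sub_mul_descFactorial h
      rw [← Real.exp_nat_mul, mul_assoc ((-1 : ℝ) ^ (k - n)), hc, hA, ← hx,
        show (n : ℝ) * -u = -(u * n) by ring]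
      ring
    · rw [Nat.choose_eq_zero_of_lt (not_le.1 h)]; simp
  have hS : Summable fun k => ‖A k‖ * (‖Real.exp (-u)‖ + ‖(-1 : ℝ)‖) ^ k := by
    refine (summable_factorial_mul_pow_div_Gamma_mul_Gamma hα₁ hα₂ hsum
      (x * (‖Real.exp (-u)‖ + ‖(-1 : ℝ)‖))).norm.congr fun k => ?_
    simp only [hA, norm_div, norm_mul, norm_pow, mul_pow]
    rw [Real.norm_of_nonneg (by positivity : (0 : ℝ) ≤ ‖Real.exp (-u)‖ + ‖(-1 : ℝ)‖)]
    ring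
  calc _ = ∑' (n : ℕ) (k : ℕ), A k * (Real.exp (-u) ^ n * (-1) ^ (k - n) * (k.choose n : ℝ)) :=
        tsum_congr hterm
    _ = ∑' (k : ℕ) (n : ℕ), A k * (Real.exp (-u) ^ n * (-1) ^ (k - n) * (k.choose n : ℝ)) :=
        (summable_mul_choose_mul_pow hS).tsum_comm
    _ = _ := tsum_congr fun k => by
        rw [tsum_mul_choose_mul_pow, hA, show -(x * (1 - Real.exp (-u)))
          = x * (Real.exp (-u) + -1) by ring, mul_pow]
        ring
end

section
/- Let α₁, α₂ ∈ (0,1] with α₁ + α₂ > 1 and let 0 < β ≤ 1. Then for every u ∈ ℝ and all t₁ ≥ 0, t₂ ≥ 0, lim_{n→∞} Σ_{k=0}^∞ k! ( − n^{2β} (1 − e^{−u²/(2n²)})^β t₁^{α₁} t₂^{α₂} )ᵏ / ( Γ(kα₁+1) Γ(kα₂+1) ) = Σ_{k=0}^∞ k! ( − (u²/2)^β t₁^{α₁} t₂^{α₂} )ᵏ / ( Γ(kα₁+1) Γ(kα₂+1) ), where n ranges over the positive integers. -/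
open Filter Topology MeasureTheory Set in
/-- Restricting Euler's integral to `(x, ∞)` gives `x ^ s * e ^ (-x) ≤ Γ(s + 1)`. -/
theorem rpow_mul_exp_neg_le_Gamma_add_one {s x : ℝ} (hs : 0 ≤ s) (hx : 0 ≤ x) :
    x ^ s * Real.exp (-x) ≤ Real.Gamma (s + 1) := by
  have hint : IntegrableOn (fun t : ℝ => Real.exp (-t) * t ^ (s + 1 - 1)) (Ioi 0) :=
    Real.GammaIntegral_convergent (by linarith)
  have hsub : Ioi x ⊆ Ioi (0 : ℝ) := Ioi_subset_Ioi hx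
  have hexp : IntegrableOn (fun t : ℝ => Real.exp (-t)) (Ioi x) := integrableOn_exp_neg_Ioi x
  rw [Real.Gamma_eq_integral (by linarith)]
  calc x ^ s * Real.exp (-x) = ∫ t in Ioi x, x ^ s * Real.exp (-t) := by
        rw [integral_const_mul, integral_exp_neg_Ioi]
    _ ≤ ∫ t in Ioi x, Real.exp (-t) * t ^ (s + 1 - 1) := by
        refine setIntegral_mono_on (hexp.const_mul _) (hint.mono_set hsub) measurableSet_Ioi ?_
        intro t ht
        rw [add_sub_cancel_right, mul_comm]
        gcongr
        exact le_of_lt ht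
    _ ≤ ∫ t in Ioi 0, Real.exp (-t) * t ^ (s + 1 - 1) := by
        refine setIntegral_mono_set hint ?_ hsub.eventuallyLE
        filter_upwards [ae_restrict_mem measurableSet_Ioi] with t ht
        have : (0 : ℝ) < t := ht
        simp only [Pi.zero_apply]
        positivity

open Filter Topology in
theorem summable_wright22_term {α₁ α₂ : ℝ} (hα₁ : 0 < α₁) (hα₂ : 0 < α₂) (hsum : 1 < α₁ + α₂)
    {R : ℝ} (hR : 0 ≤ R) :
    Summable fun k : ℕ => (k.factorial : ℝ) * R ^ k /
      (Real.Gamma ((k : ℝ) * α₁ + 1) * Real.Gamma ((k : ℝ) * α₂ + 1)) := by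
  have hlim : Tendsto (fun k : ℕ => (k : ℝ) ^ (-(α₁ + α₂ - 1)) * (R * Real.exp 2)) atTop (𝓝 0) := by
    simpa using ((tendsto_rpow_neg_atTop (sub_pos.2 hsum)).comp
      tendsto_natCast_atTop_atTop).mul_const (R * Real.exp 2)
  refine Summable.of_norm_bounded_eventually_nat
    (summable_geometric_of_lt_one (by norm_num : (0 : ℝ) ≤ 1 / 2) (by norm_num)) ?_
  filter_upwards [hlim.eventually (ge_mem_nhds (by norm_num : (0 : ℝ) < 1 / 2)),
    eventually_gt_atTop 0] with k hk hk0
  have hkpos : (0 : ℝ) < k := by exact_mod_cast hk0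
  have h₁ := rpow_mul_exp_neg_le_Gamma_add_one (s := k * α₁) (by positivity) hkpos.le
  have h₂ := rpow_mul_exp_neg_le_Gamma_add_one (s := k * α₂) (by positivity) hkpos.le
  have hfac : (k.factorial : ℝ) ≤ (k : ℝ) ^ k := by exact_mod_cast Nat.factorial_le_pow k
  have hG₁ : 0 < Real.Gamma (k * α₁ + 1) := Real.Gamma_pos_of_pos (by positivity)
  have hG₂ : 0 < Real.Gamma (k * α₂ + 1) := Real.Gamma_pos_of_pos (by positivity)
  rw [Real.norm_of_nonneg (by positivity)]
  calc _ ≤ (k : ℝ) ^ k * R ^ k /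
        (((k : ℝ) ^ (k * α₁) * Real.exp (-k)) * ((k : ℝ) ^ (k * α₂) * Real.exp (-k))) := by
        gcongr
    _ = ((k : ℝ) ^ (-(α₁ + α₂ - 1)) * (R * Real.exp 2)) ^ k := by
        rw [div_eq_iff (by positivity), mul_pow, mul_pow, ← Real.rpow_natCast (_ ^ (_ : ℝ)) k,
          ← Real.rpow_mul hkpos.le, ← Real.exp_nat_mul, ← Real.rpow_natCast (k : ℝ) k]
        have hpow : (k : ℝ) ^ (k : ℝ) =
            (k : ℝ) ^ (-(α₁ + α₂ - 1) * k) * (k : ℝ) ^ (k * α₁) * (k : ℝ) ^ (k * α₂) := by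
          rw [← Real.rpow_add hkpos, ← Real.rpow_add hkpos]
          ring_nf
        have hexp : Real.exp (k * 2) * Real.exp (-k) * Real.exp (-k) = 1 := by
          rw [← Real.exp_add, ← Real.exp_add, Real.exp_eq_one_iff]
          ring
        rw [hpow]
        linear_combination (-((k : ℝ) ^ (-(α₁ + α₂ - 1) * k) * (k : ℝ) ^ (k * α₁) *
          (k : ℝ) ^ (k * α₂) * R ^ k)) * hexp
    _ ≤ (1 / 2) ^ k := by gcongr

open Filter Topology in
theorem continuous_wright22 {α₁ α₂ : ℝ} (hα₁ : 0 < α₁) (hα₂ : 0 < α₂) (hsum : 1 < α₁ + α₂) :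
    Continuous (wright22 α₁ α₂) := by
  refine continuous_iff_continuousAt.2 fun x => ?_
  refine tendsto_tsum_of_dominated_convergence
    (summable_wright22_term hα₁ hα₂ hsum (R := |x| + 1) (by positivity)) (fun k => ?_) ?_
  · exact ((tendsto_id.pow k).const_mul _).div_const _
  · filter_upwards [(continuous_abs.tendsto x).eventually (ge_mem_nhds (lt_add_one |x|))]
      with y hy k
    have hG₁ : 0 < Real.Gamma (k * α₁ + 1) := Real.Gamma_pos_of_pos (by positivity)
    have hG₂ : 0 < Real.Gamma (k * α₂ + 1) := Real.Gamma_pos_of_pos (by positivity)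
    rw [norm_div, norm_mul, norm_pow, Real.norm_eq_abs y, Real.norm_of_nonneg (by positivity),
      Real.norm_of_nonneg (mul_pos hG₁ hG₂).le]
    gcongr

open Filter Topology in
theorem tendsto_sq_mul_one_sub_exp (c : ℝ) :
    Tendsto (fun n : ℕ => (n : ℝ) ^ 2 * (1 - Real.exp (-c / (n : ℝ) ^ 2))) atTop (𝓝 c) := by
  have hd : HasDerivAt (fun h : ℝ => 1 - Real.exp (-c * h)) c 0 := by
    simpa using (((hasDerivAt_id (0 : ℝ)).const_mul (-c)).exp).const_sub 1
  have hinv : Tendsto (fun n : ℕ => ((n : ℝ) ^ 2)⁻¹) atTop (𝓝[≠] 0) := by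
    refine tendsto_nhdsWithin_iff.2 ⟨?_, ?_⟩
    · exact ((tendsto_pow_atTop two_ne_zero).comp tendsto_natCast_atTop_atTop).inv_tendsto_atTop
    · filter_upwards [eventually_ne_atTop 0] with n hn
      simpa using hn
  refine ((hasDerivAt_iff_tendsto_slope_zero.1 hd).comp hinv).congr fun n => ?_
  simp [div_eq_mul_inv]

/-- Convergence of the characteristic function of the scaled space-time fractional
compound Poisson random field with normal compounding:
`₂Ψ₂[...|-n^{2β}(1-e^{-u²/(2n²)})^β t₁^{α₁}t₂^{α₂}] → ₂Ψ₂[...|-(u²/2)^β t₁^{α₁}t₂^{α₂}]`. -/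
theorem stmt18 (α₁ α₂ β : ℝ) (hα₁ : 0 < α₁) (hα₁' : α₁ ≤ 1) (hα₂ : 0 < α₂) (hα₂' : α₂ ≤ 1)
    (hsum : 1 < α₁ + α₂) (hβ : 0 < β) (hβ1 : β ≤ 1)
    (u t₁ t₂ : ℝ) (ht₁ : 0 ≤ t₁) (ht₂ : 0 ≤ t₂) :
    Filter.Tendsto
      (fun n : ℕ =>
        wright22 α₁ α₂
          (-((n : ℝ) ^ (2 * β) * (1 - Real.exp (-u ^ 2 / (2 * (n : ℝ) ^ 2))) ^ β
            * t₁ ^ α₁ * t₂ ^ α₂)))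
      Filter.atTop
      (nhds (wright22 α₁ α₂ (-((u ^ 2 / 2) ^ β * t₁ ^ α₁ * t₂ ^ α₂)))) := by
  have harg (n : ℕ) : -u ^ 2 / (2 * (n : ℝ) ^ 2) = -(u ^ 2 / 2) / (n : ℝ) ^ 2 := by
    rw [← neg_div, div_div]
  have hfactor (n : ℕ) :
      ((n : ℝ) ^ 2 * (1 - Real.exp (-(u ^ 2 / 2) / (n : ℝ) ^ 2))) ^ β =
        (n : ℝ) ^ (2 * β) * (1 - Real.exp (-u ^ 2 / (2 * (n : ℝ) ^ 2))) ^ β := by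
    have hexp : Real.exp (-(u ^ 2 / 2) / (n : ℝ) ^ 2) ≤ 1 :=
      Real.exp_le_one_iff.2 (div_nonpos_of_nonpos_of_nonneg (by nlinarith [sq_nonneg u])
        (by positivity))
    rw [harg, Real.mul_rpow (by positivity) (sub_nonneg.2 hexp), Real.rpow_mul n.cast_nonneg,
      Real.rpow_two]
  have hlim := (tendsto_sq_mul_one_sub_exp (u ^ 2 / 2)).rpow_const (p := β) (Or.inr hβ.le)
  simp only [hfactor] at hlim
  exact ((continuous_wright22 hα₁ hα₂ hsum).tendsto _).comp
    ((hlim.mul_const (t₁ ^ α₁)).mul_const (t₂ ^ α₂)).neg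
end
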